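/- arXiv:2602.04124 — 3 statements merged into one kernel-verified Lean document; each statement's English description precedes it below -/
import Mathlib

section
/- Let Θ be a measurable space equipped with a measure ξ, let Δ ≥ 0, and let L, L' : Θ → ℝ be measurable functions such that |L(θ) − L'(θ)| ≤ Δ for every θ ∈ Θ. Assume 0 < ∫_Θ exp(L(θ)) dξ(θ) < ∞ and 0 < ∫_Θ exp(L'(θ)) dξ(θ) < ∞. Then for every measurable set B ⊆ Θ, (∫_B exp(L(θ)) dξ(θ)) / (∫_Θ exp(L(θ)) dξ(θ)) ≤ exp(2Δ) · (∫_B exp(L'(θ)) dξ(θ)) / (∫_Θ exp(L'(θ)) dξ(θ)). -/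
open MeasureTheory Real

/-- A pointwise bound `f ≤ g + Δ` on exponents scales the exponential integral over any set
by at most `exp Δ`. -/
theorem setIntegral_exp_le_exp_mul {Θ : Type*} [MeasurableSpace Θ] {ξ : Measure Θ} {Δ : ℝ}
    {f g : Θ → ℝ} (hfg : ∀ θ, f θ ≤ g θ + Δ)
    (hf : Integrable (fun θ => exp (f θ)) ξ) (hg : Integrable (fun θ => exp (g θ)) ξ)
    (B : Set Θ) :
    ∫ θ in B, exp (f θ) ∂ξ ≤ exp Δ * ∫ θ in B, exp (g θ) ∂ξ := by
  rw [← integral_const_mul]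
  refine integral_mono hf.integrableOn (hg.integrableOn.const_mul _) fun θ => ?_
  simp only [← exp_add, exp_le_exp]
  linarith [hfg θ]

/-- Exponential-tilting (differential-privacy style) bound for pseudo posteriors:
if two log-pseudo-likelihoods differ pointwise by at most `Δ`, the corresponding
normalized pseudo posteriors satisfy an `exp (2Δ)` likelihood-ratio bound. -/
theorem pseudo_posterior_ratio_bound
    {Θ : Type*} [MeasurableSpace Θ] (ξ : Measure Θ) (Δ : ℝ) (hΔ : 0 ≤ Δ)
    (L L' : Θ → ℝ) (hL : Measurable L) (hL' : Measurable L')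
    (hdiff : ∀ θ : Θ, |L θ - L' θ| ≤ Δ)
    (hint : Integrable (fun θ => exp (L θ)) ξ)
    (hint' : Integrable (fun θ => exp (L' θ)) ξ)
    (hpos : 0 < ∫ θ, exp (L θ) ∂ξ)
    (hpos' : 0 < ∫ θ, exp (L' θ) ∂ξ) :
    ∀ B : Set Θ, MeasurableSet B →
      (∫ θ in B, exp (L θ) ∂ξ) / (∫ θ, exp (L θ) ∂ξ) ≤
        exp (2 * Δ) * ((∫ θ in B, exp (L' θ) ∂ξ) / (∫ θ, exp (L' θ) ∂ξ)) := by
  intro B _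
  have hnum : ∫ θ in B, exp (L θ) ∂ξ ≤ exp Δ * ∫ θ in B, exp (L' θ) ∂ξ :=
    setIntegral_exp_le_exp_mul (fun θ => by linarith [(abs_le.mp (hdiff θ)).2]) hint hint' B
  have hden : ∫ θ, exp (L' θ) ∂ξ ≤ exp Δ * ∫ θ, exp (L θ) ∂ξ := by
    simpa only [setIntegral_univ] using
      setIntegral_exp_le_exp_mul (fun θ => by linarith [(abs_le.mp (hdiff θ)).1]) hint' hint
        Set.univ
  have hB : 0 ≤ ∫ θ in B, exp (L' θ) ∂ξ := integral_nonneg fun θ => (exp_pos _).le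
  rw [← mul_div_assoc, div_le_div_iff₀ hpos hpos', two_mul, exp_add]
  calc (∫ θ in B, exp (L θ) ∂ξ) * ∫ θ, exp (L' θ) ∂ξ
      ≤ (exp Δ * ∫ θ in B, exp (L' θ) ∂ξ) * (exp Δ * ∫ θ, exp (L θ) ∂ξ) :=
        mul_le_mul hnum hden hpos'.le (by positivity)
    _ = exp Δ * exp Δ * (∫ θ in B, exp (L' θ) ∂ξ) * ∫ θ, exp (L θ) ∂ξ := by ring
end

section
/- Let Θ be a measurable space equipped with a measure ξ, let Δ ≥ 0, and let L, L' : Θ → ℝ be measurable functions such that |L(θ) − L'(θ)| ≤ Δ for every θ ∈ Θ. Assume 0 < ∫_Θ exp(L(θ)) dξ(θ) < ∞ and 0 < ∫_Θ exp(L'(θ)) dξ(θ) < ∞. Then for every measurable set B ⊆ Θ, the two pseudo posterior probabilities ξ^L(B) = (∫_B exp(L) dξ)/(∫_Θ exp(L) dξ) and ξ^{L'}(B) = (∫_B exp(L') dξ)/(∫_Θ exp(L') dξ) satisfy the two-sided bound exp(−2Δ) · ξ^{L'}(B) ≤ ξ^L(B) ≤ exp(2Δ) · ξ^{L'}(B).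 -/
open MeasureTheory Real

theorem integral_exp_le_exp_mul_integral_exp {Θ : Type*} [MeasurableSpace Θ] {μ : Measure Θ}
    {Δ : ℝ} {f g : Θ → ℝ} (hfg : ∀ θ, f θ ≤ Δ + g θ)
    (hf : Integrable (fun θ => exp (f θ)) μ) (hg : Integrable (fun θ => exp (g θ)) μ) :
    ∫ θ, exp (f θ) ∂μ ≤ exp Δ * ∫ θ, exp (g θ) ∂μ := by
  rw [← integral_const_mul]
  refine integral_mono hf (hg.const_mul _) fun θ => ?_
  simpa only [← exp_add] using exp_le_exp.2 (hfg θ)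

theorem setIntegral_exp_div_integral_exp_le {Θ : Type*} [MeasurableSpace Θ] {ξ : Measure Θ}
    {Δ : ℝ} {f g : Θ → ℝ} (hfg : ∀ θ, |f θ - g θ| ≤ Δ)
    (hf : Integrable (fun θ => exp (f θ)) ξ) (hg : Integrable (fun θ => exp (g θ)) ξ)
    (hf_pos : 0 < ∫ θ, exp (f θ) ∂ξ) (hg_pos : 0 < ∫ θ, exp (g θ) ∂ξ) (B : Set Θ) :
    (∫ θ in B, exp (f θ) ∂ξ) / (∫ θ, exp (f θ) ∂ξ) ≤
      exp (2 * Δ) * ((∫ θ in B, exp (g θ) ∂ξ) / (∫ θ, exp (g θ) ∂ξ)) := by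
  have num_le : ∫ θ in B, exp (f θ) ∂ξ ≤ exp Δ * ∫ θ in B, exp (g θ) ∂ξ :=
    integral_exp_le_exp_mul_integral_exp (fun θ => by linarith [(abs_le.1 (hfg θ)).2])
      hf.integrableOn hg.integrableOn
  have den_le : ∫ θ, exp (g θ) ∂ξ ≤ exp Δ * ∫ θ, exp (f θ) ∂ξ :=
    integral_exp_le_exp_mul_integral_exp (fun θ => by linarith [(abs_le.1 (hfg θ)).1]) hg hf
  have num_nonneg : 0 ≤ ∫ θ in B, exp (g θ) ∂ξ := integral_nonneg fun θ => (exp_pos _).le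
  rw [← mul_div_assoc, div_le_div_iff₀ hf_pos hg_pos, two_mul, exp_add]
  calc (∫ θ in B, exp (f θ) ∂ξ) * ∫ θ, exp (g θ) ∂ξ
      ≤ (exp Δ * ∫ θ in B, exp (g θ) ∂ξ) * (exp Δ * ∫ θ, exp (f θ) ∂ξ) :=
        mul_le_mul num_le den_le hg_pos.le (by positivity)
    _ = exp Δ * exp Δ * (∫ θ in B, exp (g θ) ∂ξ) * ∫ θ, exp (f θ) ∂ξ := by ring

/-- Two-sided differential-privacy style bound for pseudo posteriors: if two
log-pseudo-likelihoods differ pointwise by at most `Δ`, then the two pseudo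
posterior probabilities of any measurable set `B` are within a factor
`exp (2Δ)` of each other. -/
theorem pseudo_posterior_two_sided_bound
    {Θ : Type*} [MeasurableSpace Θ] (ξ : Measure Θ) (Δ : ℝ) (hΔ : 0 ≤ Δ)
    (L L' : Θ → ℝ) (hL : Measurable L) (hL' : Measurable L')
    (hdiff : ∀ θ : Θ, |L θ - L' θ| ≤ Δ)
    (hint : Integrable (fun θ => exp (L θ)) ξ)
    (hint' : Integrable (fun θ => exp (L' θ)) ξ)
    (hpos : 0 < ∫ θ, exp (L θ) ∂ξ)
    (hpos' : 0 < ∫ θ, exp (L' θ) ∂ξ) :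
    ∀ B : Set Θ, MeasurableSet B →
      exp (-(2 * Δ)) * ((∫ θ in B, exp (L' θ) ∂ξ) / (∫ θ, exp (L' θ) ∂ξ)) ≤
        (∫ θ in B, exp (L θ) ∂ξ) / (∫ θ, exp (L θ) ∂ξ) ∧
      (∫ θ in B, exp (L θ) ∂ξ) / (∫ θ, exp (L θ) ∂ξ) ≤
        exp (2 * Δ) * ((∫ θ in B, exp (L' θ) ∂ξ) / (∫ θ, exp (L' θ) ∂ξ)) := by
  intro B _
  refine ⟨?_, setIntegral_exp_div_integral_exp_le hdiff hint hint' hpos hpos' B⟩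
  rw [exp_neg, inv_mul_le_iff₀ (exp_pos _)]
  exact setIntegral_exp_div_integral_exp_le
    (fun θ => (abs_sub_comm _ _).trans_le (hdiff θ)) hint' hint hpos' hpos B
end

section
/- (Range-truncated privacy under the pseudo posterior mechanism.) Let Θ be a measurable space with prior measure ξ, let X be a measurable space with a σ-finite measure μ, and let κ be a Markov kernel from Θ to X such that for each θ, κ(θ) = μ.withDensity(p(θ,·)) for a jointly measurable density p : Θ × X → ℝ≥0. Let x_1,…,x_n ∈ X with p(θ, x_i) > 0 for all θ and i, let R_1,…,R_n ⊆ X be measurable sets with x_i ∈ R_i and κ(θ)(R_i) > 0 for all θ and i, and let α_i ∈ [0,1]. Define the range-truncated pseudo log-likelihood L(θ) = Σ_{i=1}^{n} (α_i·log p(θ, x_i) − log κ(θ)(R_i)), and for a fixed index j define L'(θ) = Σ_{i≠j} (α_i·log p(θ, x_i) − log κ(θ)(R_i)). Let Δ ≥ 0 satisfy |α_i·log p(θ, x_i) − log κ(θ)(R_i)| ≤ Δ for all θ and i (so Δ bounds the range-truncated sensitivity Δ_{α,I,x}). If 0 < ∫_Θ exp(L) dξ < ∞ and 0 < ∫_Θ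 exp(L') dξ < ∞, then for every measurable set B ⊆ Θ, (∫_B exp(L) dξ)/(∫_Θ exp(L) dξ) ≤ exp(2Δ) · (∫_B exp(L') dξ)/(∫_Θ exp(L') dξ); i.e., the range-truncated pseudo posterior ξ^{I^c α}(· | x) has local privacy guarantee 2Δ_{α,I,x}. -/
open MeasureTheory ProbabilityTheory Real

/-- If two log-likelihoods differ pointwise by at most `Δ`, then the normalized posterior
masses they assign to a set differ by a factor of at most `exp (2 * Δ)`. -/
theorem setIntegral_exp_div_le_of_abs_sub_le
    {Θ : Type*} [MeasurableSpace Θ] {ξ : Measure Θ} {f g : Θ → ℝ} {Δ : ℝ}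
    (hfg : ∀ θ, |f θ - g θ| ≤ Δ)
    (hf : Integrable (fun θ => exp (f θ)) ξ) (hg : Integrable (fun θ => exp (g θ)) ξ)
    (hfpos : 0 < ∫ θ, exp (f θ) ∂ξ) (hgpos : 0 < ∫ θ, exp (g θ) ∂ξ) (B : Set Θ) :
    (∫ θ in B, exp (f θ) ∂ξ) / (∫ θ, exp (f θ) ∂ξ) ≤
      exp (2 * Δ) * ((∫ θ in B, exp (g θ) ∂ξ) / (∫ θ, exp (g θ) ∂ξ)) := by
  have num : ∫ θ in B, exp (f θ) ∂ξ ≤ exp Δ * ∫ θ in B, exp (g θ) ∂ξ := by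
    rw [← integral_const_mul]
    refine integral_mono hf.integrableOn (hg.integrableOn.const_mul _) fun θ => ?_
    dsimp only
    rw [← exp_add]
    exact exp_le_exp.2 (by linarith [(abs_le.1 (hfg θ)).2])
  have den : ∫ θ, exp (g θ) ∂ξ ≤ exp Δ * ∫ θ, exp (f θ) ∂ξ := by
    rw [← integral_const_mul]
    refine integral_mono hg (hf.const_mul _) fun θ => ?_
    dsimp only
    rw [← exp_add]
    exact exp_le_exp.2 (by linarith [(abs_le.1 (hfg θ)).1])
  have hB : 0 ≤ ∫ θ in B, exp (g θ) ∂ξ := integral_nonneg fun θ => (exp_pos _).le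
  rw [← mul_div_assoc, div_le_div_iff₀ hfpos hgpos, two_mul, exp_add]
  calc (∫ θ in B, exp (f θ) ∂ξ) * ∫ θ, exp (g θ) ∂ξ
      ≤ (exp Δ * ∫ θ in B, exp (g θ) ∂ξ) * (exp Δ * ∫ θ, exp (f θ) ∂ξ) :=
        mul_le_mul num den hgpos.le (by positivity)
    _ = exp Δ * exp Δ * (∫ θ in B, exp (g θ) ∂ξ) * ∫ θ, exp (f θ) ∂ξ := by ring

/-- Range-truncated privacy under the pseudo posterior mechanism: with
range-truncated pseudo log-likelihood
`L θ = ∑ i, (α i * log p(θ, x i) - log κ(θ)(R i))` and adjacent pseudo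
log-likelihood `L'` omitting record `j`, a uniform bound `Δ` on each sensitive
truncated contribution yields a local privacy guarantee `2Δ` for the
range-truncated pseudo posterior. -/
theorem range_truncated_privacy_pseudo_posterior
    {Θ X : Type*} [MeasurableSpace Θ] [MeasurableSpace X]
    (ξ : Measure Θ) (μ : Measure X) [SigmaFinite μ]
    (κ : Kernel Θ X) [IsMarkovKernel κ]
    (p : Θ → X → NNReal) (hp : Measurable (Function.uncurry p))
    (hκ : ∀ θ : Θ, κ θ = μ.withDensity (fun x => (p θ x : ENNReal)))
    (n : ℕ) (hn : 1 ≤ n) (x : Fin n → X)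
    (hxpos : ∀ θ : Θ, ∀ i, 0 < p θ (x i))
    (R : Fin n → Set X) (hRmeas : ∀ i, MeasurableSet (R i))
    (hxR : ∀ i, x i ∈ R i) (hRpos : ∀ θ : Θ, ∀ i, 0 < κ θ (R i))
    (α : Fin n → ℝ) (hα : ∀ i, α i ∈ Set.Icc (0 : ℝ) 1)
    (j : Fin n) (Δ : ℝ) (hΔ : 0 ≤ Δ)
    (hsens : ∀ θ : Θ, ∀ i,
      |α i * Real.log (p θ (x i)) - Real.log ((κ θ (R i)).toReal)| ≤ Δ)
    (L L' : Θ → ℝ)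
    (hLdef : ∀ θ, L θ =
      ∑ i, (α i * Real.log (p θ (x i)) - Real.log ((κ θ (R i)).toReal)))
    (hL'def : ∀ θ, L' θ =
      ∑ i ∈ Finset.univ.erase j,
        (α i * Real.log (p θ (x i)) - Real.log ((κ θ (R i)).toReal)))
    (hint : Integrable (fun θ => exp (L θ)) ξ)
    (hint' : Integrable (fun θ => exp (L' θ)) ξ)
    (hpos : 0 < ∫ θ, exp (L θ) ∂ξ)
    (hpos' : 0 < ∫ θ, exp (L' θ) ∂ξ) :
    ∀ B : Set Θ, MeasurableSet B →
      (∫ θ in B, exp (L θ) ∂ξ) / (∫ θ, exp (L θ) ∂ξ) ≤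
        exp (2 * Δ) * ((∫ θ in B, exp (L' θ) ∂ξ) / (∫ θ, exp (L' θ) ∂ξ)) := by
  intro B _
  refine setIntegral_exp_div_le_of_abs_sub_le (fun θ => ?_) hint hint' hpos hpos' B
  rw [hLdef, hL'def, ← Finset.add_sum_erase _ _ (Finset.mem_univ j), add_sub_cancel_right]
  exact hsens θ j
end
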